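/- Let β satisfy 0 < β < 4, let k = 4/(4−β), and let f₋₊(x,y,z) = β(x²y²+y²z²+z²x²) − (x²+y²+z²−1/2)² + (1−k)/4. Then the set of singular points of the quartic Q⁻⁺(k) = {f₋₊ = 0}, that is, the set of points at which f₋₊ and all three of its partial derivatives vanish, is exactly the set of twelve points obtained from (t,t,0), with t = 1/√(4−β), by permuting the coordinates and changing signs of coordinates: (±t,±t,0), (±t,0,±t), (0,±t,±t) (the centers of the edges of a cube). -/

import Mathlib

/-- The quartic polynomial `β·v - (u - 1/2)² + (1-k)/4` defining `Q⁻⁺(k)`. -/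
noncomputable def fMP (β k : ℝ) (p : EuclideanSpace ℝ (Fin 3)) : ℝ :=
  β * ((p 0)^2*(p 1)^2 + (p 1)^2*(p 2)^2 + (p 2)^2*(p 0)^2)
    - ((p 0)^2 + (p 1)^2 + (p 2)^2 - 1/2)^2 + (1 - k)/4

/-- The derivative of `fMP β k` in terms of the coordinate projections. -/
theorem hasFDerivAt_fMP (β k : ℝ) (p : EuclideanSpace ℝ (Fin 3)) :
    HasFDerivAt (fMP β k)
      ((2 * p 0 * (β * ((p 1)^2 + (p 2)^2) - 2 * ((p 0)^2 + (p 1)^2 + (p 2)^2 - 1/2))) •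
          (EuclideanSpace.proj 0 : EuclideanSpace ℝ (Fin 3) →L[ℝ] ℝ)
        + (2 * p 1 * (β * ((p 0)^2 + (p 2)^2) - 2 * ((p 0)^2 + (p 1)^2 + (p 2)^2 - 1/2))) •
          (EuclideanSpace.proj 1 : EuclideanSpace ℝ (Fin 3) →L[ℝ] ℝ)
        + (2 * p 2 * (β * ((p 0)^2 + (p 1)^2) - 2 * ((p 0)^2 + (p 1)^2 + (p 2)^2 - 1/2))) •
          (EuclideanSpace.proj 2 : EuclideanSpace ℝ (Fin 3) →L[ℝ] ℝ)) p := by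
  have hp (i : Fin 3) : HasFDerivAt (fun q : EuclideanSpace ℝ (Fin 3) => (q i)^2) _ p :=
    (EuclideanSpace.proj i : EuclideanSpace ℝ (Fin 3) →L[ℝ] ℝ).hasFDerivAt.pow 2
  have h := ((((((hp 0).mul (hp 1)).add ((hp 1).mul (hp 2))).add
    ((hp 2).mul (hp 0))).const_mul β).sub
      (((((hp 0).add (hp 1)).add (hp 2)).sub_const (1/2)).pow 2)).add_const ((1 - k)/4)
  refine HasFDerivAt.congr_fderiv h ?_
  ext v
  simp
  ring

/-- The derivative of `fMP β k` vanishes iff its three partial derivatives do. -/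
theorem fderiv_fMP_eq_zero_iff (β k : ℝ) (p : EuclideanSpace ℝ (Fin 3)) :
    fderiv ℝ (fMP β k) p = 0 ↔
      p 0 * (β * ((p 1)^2 + (p 2)^2) - 2 * ((p 0)^2 + (p 1)^2 + (p 2)^2 - 1/2)) = 0 ∧
      p 1 * (β * ((p 0)^2 + (p 2)^2) - 2 * ((p 0)^2 + (p 1)^2 + (p 2)^2 - 1/2)) = 0 ∧
      p 2 * (β * ((p 0)^2 + (p 1)^2) - 2 * ((p 0)^2 + (p 1)^2 + (p 2)^2 - 1/2)) = 0 := by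
  rw [(hasFDerivAt_fMP β k p).fderiv]
  constructor
  · intro h
    have h' (i : Fin 3) := DFunLike.congr_fun h (EuclideanSpace.single i (1 : ℝ))
    have h0 := h' 0
    have h1 := h' 1
    have h2 := h' 2
    simp [-mul_eq_zero] at h0 h1 h2
    refine ⟨?_, ?_, ?_⟩ <;> linarith
  · rintro ⟨h0, h1, h2⟩
    simp only [mul_assoc, h0, h1, h2, mul_zero, zero_smul, add_zero]

/-- When one coordinate vanishes and the others do not, the remaining two partial derivatives determine the
squares of the nonzero coordinates. -/
theorem sq_mul_eq_one_of_partials {β x y : ℝ} (hβ : 0 < β) (hx : x ≠ 0) (hy : y ≠ 0)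
    (h0 : x * (β * y^2 - 2 * (x^2 + y^2 - 1/2)) = 0)
    (h1 : y * (β * x^2 - 2 * (x^2 + y^2 - 1/2)) = 0) :
    x^2 * (4 - β) = 1 ∧ y^2 * (4 - β) = 1 := by
  have e0 := (mul_eq_zero.mp h0).resolve_left hx
  have e1 := (mul_eq_zero.mp h1).resolve_left hy
  have e : x^2 = y^2 := mul_left_cancel₀ hβ.ne' (by linarith)
  rw [e] at e0 e1 ⊢
  constructor <;> linarith

/-- A number whose square is `1/c` is one of the two square roots of `1/c`. -/
theorem eq_or_eq_neg_one_div_sqrt {c x : ℝ} (hc : 0 < c) (h : x^2 * c = 1) :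
    x = 1 / Real.sqrt c ∨ x = -(1 / Real.sqrt c) := by
  apply sq_eq_sq_iff_eq_or_eq_neg.mp
  rw [div_pow, Real.sq_sqrt hc.le, one_pow]
  exact eq_div_of_mul_eq hc.ne' h

/-- The two square roots of `1/c` have square `1/c`. -/
theorem sq_eq_of_eq_or_eq_neg {c x : ℝ} (hc : 0 < c)
    (h : x = 1 / Real.sqrt c ∨ x = -(1 / Real.sqrt c)) : x^2 = 1 / c := by
  rw [sq_eq_sq_iff_eq_or_eq_neg.mpr h, div_pow, Real.sq_sqrt hc.le, one_pow]

/-- for `0 < β < 4` and `k = 4/(4-β)`, the singular points of `Q⁻⁺(k)`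
are the twelve points `(±t,±t,0), (±t,0,±t), (0,±t,±t)` with `t = 1/√(4-β)`
(centers of the edges of a cube). -/
theorem stmt_18 (β : ℝ) (hβ0 : 0 < β) (hβ4 : β < 4) (k : ℝ) (hk : k = 4/(4-β)) :
    {p : EuclideanSpace ℝ (Fin 3) |
        fMP β k p = 0 ∧ fderiv ℝ (fMP β k) p = 0} =
      {p : EuclideanSpace ℝ (Fin 3) | ∃ a b : ℝ,
        (a = 1/Real.sqrt (4-β) ∨ a = -(1/Real.sqrt (4-β))) ∧
        (b = 1/Real.sqrt (4-β) ∨ b = -(1/Real.sqrt (4-β))) ∧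
        ((p 0 = a ∧ p 1 = b ∧ p 2 = 0) ∨
         (p 0 = a ∧ p 1 = 0 ∧ p 2 = b) ∨
         (p 0 = 0 ∧ p 1 = a ∧ p 2 = b))} := by
  have hc : 0 < 4 - β := by linarith
  have hk4 : k * (4 - β) = 4 := by rw [hk]; field_simp
  have hk1 : 1 < k := by rw [hk, lt_div_iff₀ hc]; linarith
  ext p
  simp only [Set.mem_ofPred_eq, fderiv_fMP_eq_zero_iff, fMP]
  generalize p 0 = x
  generalize p 1 = y
  generalize p 2 = z
  constructor
  · rintro ⟨hf, h0, h1, h2⟩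
    have root {s : ℝ} := eq_or_eq_neg_one_div_sqrt (x := s) hc
    by_cases hx : x = 0
    · subst hx
      by_cases hy : y = 0
      · subst hy
        exfalso
        by_cases hz : z = 0
        · subst hz
          linarith
        · have e := (mul_eq_zero.mp h2).resolve_left hz
          nlinarith
      · by_cases hz : z = 0
        · subst hz
          exfalso
          have e := (mul_eq_zero.mp h1).resolve_left hy
          nlinarith
        · obtain ⟨ey, ez⟩ := sq_mul_eq_one_of_partials hβ0 hy hz
            (by linear_combination h1) (by linear_combination h2)
          exact ⟨y, z, root ey, root ez, by simp⟩
    · by_cases hy : y = 0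
      · subst hy
        by_cases hz : z = 0
        · subst hz
          exfalso
          have e := (mul_eq_zero.mp h0).resolve_left hx
          nlinarith
        · obtain ⟨ex, ez⟩ := sq_mul_eq_one_of_partials hβ0 hx hz
            (by linear_combination h0) (by linear_combination h2)
          exact ⟨x, z, root ex, root ez, by simp⟩
      · by_cases hz : z = 0
        · subst hz
          obtain ⟨ex, ey⟩ := sq_mul_eq_one_of_partials hβ0 hx hy
            (by linear_combination h0) (by linear_combination h1)
          exact ⟨x, y, root ex, root ey, by simp⟩
        · exfalso
          have e0 := (mul_eq_zero.mp h0).resolve_left hx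
          have e1 := (mul_eq_zero.mp h1).resolve_left hy
          have e2 := (mul_eq_zero.mp h2).resolve_left hz
          have exy : y^2 = x^2 := mul_left_cancel₀ hβ0.ne' (by linarith)
          have exz : z^2 = x^2 := mul_left_cancel₀ hβ0.ne' (by linarith)
          rw [exy, exz] at e0 hf
          have hX : x^2 * (6 - 2 * β) = 1 := by linear_combination -e0
          have hu : 3 * x^2 - 1/2 = β * x^2 := by linear_combination -e0 / 2
          have hv : β * (2 * x^2 * (4 - β) - 1) = 0 := by
            have hf' : β * x^2 / 2 + (1 - k)/4 = 0 := by
              rw [show x^2 + x^2 + x^2 - 1/2 = β * x^2 by linarith] at hf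
              linear_combination hf - β * x^2 / 2 * hX
            linear_combination 4 * (4 - β) * hf' + hk4
          have := (mul_eq_zero.mp hv).resolve_left hβ0.ne'
          exact hx (pow_eq_zero_iff two_ne_zero |>.mp (by linarith))
  · rintro ⟨a, b, ha, hb, h⟩
    have ha2 := sq_eq_of_eq_or_eq_neg hc ha
    have hb2 := sq_eq_of_eq_or_eq_neg hc hb
    rcases h with ⟨rfl, rfl, rfl⟩ | ⟨rfl, rfl, rfl⟩ | ⟨rfl, rfl, rfl⟩ <;>
      · rw [ha2, hb2, hk]
        refine ⟨?_, ?_, ?_, ?_⟩ <;> field_simp <;> ring
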